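/- For n ≥ 3, the plethysm h_2[h_1 h_{n-1}] has Schur expansion: Σ_{1≤a≤n-1, a odd} s_{(1,1,a,2n-2-a)} + Σ_{2≤a≤n-1, a even} s_{(2,a,2n-2-a)} + s_{(1,1,2n-2)} + 2 Σ_{2≤a≤n-1} s_{(1,a,2n-1-a)} + s_{(1,2n-1)} + 3 Σ_{2≤a≤n-1, a even} s_{(a,2n-a)} + Σ_{2≤a≤n-1, a odd} s_{(a,2n-a)} + 2·[n even]·s_{(n,n)} + s_{(2n)}, where partitions are written with parts in weakly decreasing order from the largest (so e.g. (1,1,a,2n-2-a) means parts 2n-2-a ≥ a ≥ 1 ≥ 1). -/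

import Mathlib

open MvPolynomial

/-- The ring of symmetric functions, modeled as the polynomial ring
`ℚ[h₁, h₂, …]` in the complete homogeneous symmetric functions (variable `i`
corresponds to `h_{i+1}`). -/
abbrev SymF : Type := MvPolynomial ℕ ℚ

/-- The complete homogeneous symmetric function `h_n` as an element of `SymF`. -/
noncomputable def hh : ℕ → SymF
  | 0 => 1
  | n + 1 => X n

/-- The expression of `h_n` in terms of the power sums (in the polynomial ring
`ℚ[p₁, p₂, …]`, variable `i` corresponding to `p_{i+1}`), via Newton's identity
`n·h_n = ∑_{i=1}^n p_i h_{n-i}`. -/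
noncomputable def hInP : ℕ → MvPolynomial ℕ ℚ
  | 0 => 1
  | n + 1 =>
      ((n + 1 : ℚ))⁻¹ • ∑ i ∈ Finset.range (n + 1), X i * hInP (n - i)
  termination_by n => n
  decreasing_by omega

/-- The power sum symmetric function `p_n` as an element of `SymF`, via Newton's
identity `p_n = n·h_n - ∑_{i=1}^{n-1} p_i h_{n-i}`. -/
noncomputable def pSym : ℕ → SymF
  | 0 => 1
  | n + 1 =>
      ((n : ℚ) + 1) • hh (n + 1) -
        ∑ i ∈ (Finset.range n).attach, pSym (i.1 + 1) * hh (n - i.1)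
  termination_by n => n
  decreasing_by
    have h := Finset.mem_range.mp i.2
    omega

/-- The isomorphism expressing a symmetric function in the power sum basis. -/
noncomputable def toP : SymF →ₐ[ℚ] MvPolynomial ℕ ℚ :=
  aeval (fun i => hInP (i + 1))

/-- `psub k g = p_k[g]`, plethysm of a power sum with `g`: substitute `p_i ↦ p_{ik}`
in the power-sum expression of `g`. -/
noncomputable def psub (k : ℕ) (g : SymF) : SymF :=
  aeval (fun i => pSym ((i + 1) * k)) (toP g)

/-- Plethysm `f[g]` of symmetric functions: substitute `p_k ↦ p_k[g]` in the
power-sum expression of `f`. -/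
noncomputable def pleth (f g : SymF) : SymF :=
  aeval (fun i => psub (i + 1) g) (toP f)

/-- `h_z` for integer index: zero for negative `z`. -/
noncomputable def hZ (z : ℤ) : SymF := if 0 ≤ z then hh z.toNat else 0

/-- The Schur function of a partition given as a weakly decreasing list of parts,
defined by the Jacobi–Trudi determinant `s_λ = det(h_{λ_i - i + j})`. -/
noncomputable def schur (l : List ℕ) : SymF :=
  (Matrix.of fun i j : Fin l.length =>
    hZ ((l.get i : ℤ) + (j : ℤ) - (i : ℤ))).det

/-- `z_λ` for the monomial `d` in the power sums: `∏_i i^{m_i} m_i!`. -/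
def zQ (d : ℕ →₀ ℕ) : ℚ :=
  d.prod fun i m => ((i : ℚ) + 1) ^ m * (Nat.factorial m : ℚ)

/-- The Hall inner product, characterized by `⟨p_λ, p_μ⟩ = δ_{λμ} z_λ`, computed in
the power sum basis. -/
noncomputable def hall (f g : SymF) : ℚ :=
  ∑ d ∈ (toP f).support, zQ d * (toP f).coeff d * (toP g).coeff d

/-- The decreasingly sorted list of parts of a partition. -/
def sortedParts {N : ℕ} (π : Nat.Partition N) : List ℕ :=
  (π.parts.sort (· ≤ ·)).reverse

theorem hZ_natCast (k : ℕ) : hZ (k : ℤ) = hh k := by simp [hZ]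

theorem hZ_of_neg {z : ℤ} (hz : z < 0) : hZ z = 0 := by simp [hZ, hz]

theorem hZ_eq {z : ℤ} (k : ℕ) (hz : z = k) : hZ z = hh k := by rw [hz, hZ_natCast]

theorem schur_one_row (p : ℕ) : schur [p] = hh p := by
  rw [← hZ_natCast p]
  simp [schur]

theorem schur_two_rows (p q : ℕ) :
    schur [p, q + 1] = hh p * hh (q + 1) - hh (p + 1) * hh q := by
  have : (Matrix.of fun i j : Fin 2 =>
      hZ (([p, q + 1].get i : ℤ) + (j : ℤ) - (i : ℤ))) =
      !![hh p, hh (p + 1); hh q, hh (q + 1)] := by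
    ext1 i j
    fin_cases i <;> fin_cases j <;>
      simp <;> exact hZ_eq _ (by omega)
  exact (congrArg Matrix.det this).trans (by rw [Matrix.det_fin_two_of])

theorem schur_three_rows_one (p q : ℕ) :
    schur [p, q + 1, 1] =
      hh 1 * (hh p * hh (q + 1) - hh (p + 1) * hh q) -
        (hh p * hh (q + 2) - hh (p + 2) * hh q) := by
  have : (Matrix.of fun i j : Fin 3 =>
      hZ (([p, q + 1, 1].get i : ℤ) + (j : ℤ) - (i : ℤ))) =
      !![hh p, hh (p + 1), hh (p + 2); hh q, hh (q + 1), hh (q + 2); 0, hh 0, hh 1] := by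
    ext1 i j
    fin_cases i <;> fin_cases j <;>
      simp <;> first
      | exact hZ_eq _ (by omega)
      | exact hZ_of_neg (by omega)
  refine (congrArg Matrix.det this).trans ?_
  rw [Matrix.det_fin_three]
  simp [show hh 0 = 1 from rfl]
  ring

theorem schur_three_rows_two (p q : ℕ) :
    schur [p, q + 1, 2] =
      hh 2 * (hh p * hh (q + 1) - hh (p + 1) * hh q) -
        hh 1 * (hh p * hh (q + 2) - hh (p + 2) * hh q) +
        (hh (p + 1) * hh (q + 2) - hh (p + 2) * hh (q + 1)) := by
  have : (Matrix.of fun i j : Fin 3 =>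
      hZ (([p, q + 1, 2].get i : ℤ) + (j : ℤ) - (i : ℤ))) =
      !![hh p, hh (p + 1), hh (p + 2); hh q, hh (q + 1), hh (q + 2); hh 0, hh 1, hh 2] := by
    ext1 i j
    fin_cases i <;> fin_cases j <;>
      simp <;> exact hZ_eq _ (by omega)
  refine (congrArg Matrix.det this).trans ?_
  rw [Matrix.det_fin_three]
  simp [show hh 0 = 1 from rfl]
  ring

theorem schur_four_rows_one_one (p q : ℕ) :
    schur [p, q + 1, 1, 1] =
      (hh 1 ^ 2 - hh 2) * (hh p * hh (q + 1) - hh (p + 1) * hh q) -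
        hh 1 * (hh p * hh (q + 2) - hh (p + 2) * hh q) +
        (hh p * hh (q + 3) - hh (p + 3) * hh q) := by
  have : (Matrix.of fun i j : Fin 4 =>
      hZ (([p, q + 1, 1, 1].get i : ℤ) + (j : ℤ) - (i : ℤ))) =
      !![hh p, hh (p + 1), hh (p + 2), hh (p + 3);
        hh q, hh (q + 1), hh (q + 2), hh (q + 3);
        0, hh 0, hh 1, hh 2; 0, 0, hh 0, hh 1] := by
    ext1 i j
    fin_cases i <;> fin_cases j <;>
      simp <;> first
      | exact hZ_eq _ (by omega)
      | exact hZ_of_neg (by omega)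
  refine (congrArg Matrix.det this).trans ?_
  rw [Matrix.det_succ_row_zero]
  simp [Fin.sum_univ_succ, Matrix.det_fin_three, Fin.succAbove, show hh 0 = 1 from rfl]
  ring

theorem aeval_hInP {φ g : ℕ → SymF} (h0 : g 0 = 1)
    (hg : ∀ m : ℕ, ((m : SymF) + 1) * g (m + 1) = ∑ i ∈ Finset.range (m + 1), φ i * g (m - i))
    (m : ℕ) : aeval φ (hInP m) = g m := by
  induction m using Nat.strong_induction_on with
  | _ m ih =>
    cases m with
    | zero => simp [hInP, h0]
    | succ m =>
      have hsum : ∑ i ∈ Finset.range (m + 1), φ i * aeval φ (hInP (m - i)) =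
          ∑ i ∈ Finset.range (m + 1), φ i * g (m - i) :=
        Finset.sum_congr rfl fun i _ => by rw [ih (m - i) (by omega)]
      have hm : ((m : ℚ) + 1) ≠ 0 := by positivity
      rw [hInP, map_smul, map_sum]
      simp only [map_mul, aeval_X]
      rw [hsum, ← hg, inv_smul_eq_iff₀ hm, Algebra.smul_def]
      simp

theorem hh_newton (m : ℕ) :
    ((m : SymF) + 1) * hh (m + 1) =
      ∑ i ∈ Finset.range (m + 1), pSym (i + 1) * hh (m - i) := by
  rw [Finset.sum_range_succ, pSym, Finset.sum_attach (Finset.range m)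
    (fun i => pSym (i + 1) * hh (m - i)), Algebra.smul_def]
  simp [show hh 0 = 1 from rfl]

theorem toP_hh (m : ℕ) : toP (hh m) = hInP m := by
  cases m with
  | zero => simp [hh, hInP]
  | succ m => simp [hh, toP]

theorem psub_one_hh (m : ℕ) : psub 1 (hh m) = hh m := by
  rw [psub, toP_hh]
  simp only [mul_one]
  exact aeval_hInP (φ := fun i => pSym (i + 1)) rfl hh_newton m

theorem psub_mul (k : ℕ) (f g : SymF) : psub k (f * g) = psub k f * psub k g := by
  simp [psub]

theorem sum_range_two_mul {R : Type*} [AddCommMonoid R] (f : ℕ → R) (k : ℕ) :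
    ∑ j ∈ Finset.range (2 * k), f j = ∑ i ∈ Finset.range k, (f (2 * i) + f (2 * i + 1)) := by
  induction k with
  | zero => simp
  | succ k ih =>
    rw [Finset.sum_range_succ, ← ih, mul_add, mul_one, Finset.sum_range_succ,
      Finset.sum_range_succ, add_assoc]

theorem psub_two_hh (m : ℕ) :
    psub 2 (hh m) =
      ∑ i ∈ Finset.range (2 * m + 1), (-1) ^ i * (hh i * hh (2 * m - i)) := by
  let H : PowerSeries SymF := PowerSeries.mk hh
  let K : PowerSeries SymF := PowerSeries.mk fun i => (-1) ^ i * hh i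
  let P : PowerSeries SymF := PowerSeries.mk fun i => pSym (i + 1)
  let Q : PowerSeries SymF := PowerSeries.mk fun i => (-1) ^ i * pSym (i + 1)
  have hH : PowerSeries.derivative SymF H = P * H := by
    ext1 k
    rw [PowerSeries.coeff_derivative, PowerSeries.coeff_mul,
      Finset.Nat.sum_antidiagonal_eq_sum_range_succ_mk]
    simp only [H, P, PowerSeries.coeff_mk]
    rw [mul_comm, hh_newton]
  have hK : PowerSeries.derivative SymF K = -(Q * K) := by
    ext1 k
    rw [PowerSeries.coeff_derivative, map_neg, PowerSeries.coeff_mul,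
      Finset.Nat.sum_antidiagonal_eq_sum_range_succ_mk]
    simp only [K, Q, PowerSeries.coeff_mk]
    rw [mul_comm, mul_left_comm, hh_newton, Finset.mul_sum, ← Finset.sum_neg_distrib]
    refine Finset.sum_congr rfl fun i hi => ?_
    have hik : i + (k - i) = k := by have := Finset.mem_range.mp hi; omega
    rw [pow_succ]
    nth_rewrite 1 [← hik]
    rw [pow_add]
    ring
  have hG : PowerSeries.derivative SymF (K * H) = (P - Q) * (K * H) := by
    rw [Derivation.leibniz, hH, hK, smul_eq_mul, smul_eq_mul]
    ring
  have hcoeff : ∀ k, PowerSeries.coeff (2 * k) (K * H) =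
      ∑ i ∈ Finset.range (2 * k + 1), (-1) ^ i * (hh i * hh (2 * k - i)) := fun k => by
    rw [PowerSeries.coeff_mul, Finset.Nat.sum_antidiagonal_eq_sum_range_succ_mk]
    simp only [H, K, PowerSeries.coeff_mk, mul_assoc]
  rw [← hcoeff, psub, toP_hh]
  refine aeval_hInP (φ := fun i => pSym ((i + 1) * 2))
    (g := fun k => PowerSeries.coeff (2 * k) (K * H)) ?_ (fun k => ?_) m
  · rw [hcoeff]
    simp [hh]
  · have h := congrArg (PowerSeries.coeff (2 * k + 1)) hG
    rw [PowerSeries.coeff_derivative, PowerSeries.coeff_mul (2 * k + 1) (P - Q),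
      Finset.Nat.sum_antidiagonal_eq_sum_range_succ_mk,
      show (2 * k + 1).succ = 2 * (k + 1) by omega, sum_range_two_mul] at h
    have h2 : (2 : SymF) ≠ 0 := two_ne_zero
    refine mul_left_cancel₀ h2 ?_
    rw [show 2 * k + 1 + 1 = 2 * (k + 1) by ring] at h
    rw [Finset.mul_sum]
    refine Eq.trans ?_ (h.trans (Finset.sum_congr rfl fun i _ => ?_))
    · push_cast
      ring
    · simp only [map_sub, P, Q, PowerSeries.coeff_mk]
      rw [show 2 * k + 1 - (2 * i + 1) = 2 * (k - i) by omega,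
        show 2 * i + 1 + 1 = (i + 1) * 2 by ring]
      simp [pow_succ, pow_mul]
      ring

theorem sum_alternating_symmetric {R : Type*} [CommRing R] (A : ℕ → R) (m : ℕ)
    (hA : ∀ i ≤ 2 * m, A (2 * m - i) = A i) :
    ∑ i ∈ Finset.range (2 * m + 1), (-1) ^ i * A i =
      2 * (∑ i ∈ Finset.range m, (-1) ^ i * A i) + (-1) ^ m * A m := by
  have h : ∑ i ∈ Finset.range m, (-1) ^ (m + 1 + i) * A (m + 1 + i) =
      ∑ i ∈ Finset.range m, (-1) ^ i * A i := by
    rw [← Finset.sum_range_reflect]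
    refine Finset.sum_congr rfl fun i hi => ?_
    have hi := Finset.mem_range.mp hi
    rw [show m + 1 + (m - 1 - i) = 2 * m - i by omega, hA i (by omega)]
    congr 1
    exact neg_one_pow_congr (by grind)
  rw [show 2 * m + 1 = (m + 1) + m by ring, Finset.sum_range_add, h, Finset.sum_range_succ]
  ring

theorem pleth_hh_two (g : SymF) :
    2 * pleth (hh 2) g = psub 1 g ^ 2 + psub 2 g := by
  have h : (2 : MvPolynomial ℕ ℚ) * hInP 2 = X 0 ^ 2 + X 1 := by
    have e : (2 : MvPolynomial ℕ ℚ) * C (1 + 1)⁻¹ = 1 := by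
      rw [← map_ofNat C 2, ← C_mul]
      norm_num
    simp [hInP, Finset.sum_range_succ, smul_eq_C_mul]
    linear_combination (X 0 ^ 2 + X 1) * e
  have := congrArg (aeval fun i => psub (i + 1) g) h
  rw [map_mul, map_ofNat, map_add, map_pow, aeval_X, aeval_X] at this
  rw [pleth, toP_hh, this]

theorem telescoping_identity {R : Type*} [CommRing R] (A B C : ℕ → R) (x y : R) (m : ℕ)
    (hm : 1 ≤ m) :
    (∑ a ∈ (Finset.Icc 1 m).filter (fun a => Odd a),
        ((x ^ 2 - y) * (A a - A (a - 1)) - x * (B (a + 1) - B (a - 1)) +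
          (C (a + 2) - C (a - 1)))) +
      (∑ a ∈ (Finset.Icc 2 m).filter (fun a => Even a),
        (y * (A a - A (a - 1)) - x * (B (a + 1) - B (a - 1)) + (C (a + 1) - C a))) +
      2 * (∑ a ∈ Finset.Icc 2 m, (x * (B a - B (a - 1)) - (C (a + 1) - C (a - 1)))) +
      3 * (∑ a ∈ (Finset.Icc 2 m).filter (fun a => Even a), (C a - C (a - 1))) +
      (∑ a ∈ (Finset.Icc 2 m).filter (fun a => Odd a), (C a - C (a - 1))) =
    (y * (2 * (∑ i ∈ Finset.range m, (-1) ^ i * A i) + (-1) ^ m * A m - A 0)) +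
      (if Even m then x ^ 2 * (-(∑ i ∈ Finset.range m, (-1) ^ i * A i))
        else x ^ 2 * (A m - ∑ i ∈ Finset.range m, (-1) ^ i * A i)) +
      x * (B m - B (m + 1) + B 0 - B 1) +
      (2 * C 2 - C 1 - C 0 + if Even m then 0 else C (m + 2) - 2 * C (m + 1) + C m) := by
  simp only [Finset.sum_filter]
  induction m, hm using Nat.le_induction with
  | base => simp; ring
  | succ m hm ih =>
    rw [Finset.sum_Icc_succ_top (by omega), Finset.sum_Icc_succ_top (by omega),
      Finset.sum_Icc_succ_top (by omega), Finset.sum_Icc_succ_top (by omega),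
      Finset.sum_Icc_succ_top (by omega), Finset.sum_range_succ]
    rcases Nat.even_or_odd m with h | h
    · have h' : Odd (m + 1) := h.add_one
      simp only [h, h', Nat.not_even_iff_odd.mpr h', if_true, if_false, h.neg_one_pow,
        h'.neg_one_pow, Nat.add_sub_cancel] at ih ⊢
      linear_combination ih
    · have h' : Even (m + 1) := h.add_one
      simp only [h', Nat.not_even_iff_odd.mpr h, Nat.not_odd_iff_even.mpr h', if_true, if_false,
        h.neg_one_pow, h'.neg_one_pow, Nat.add_sub_cancel] at ih ⊢
      linear_combination ih

/-- The Schur expansion of `h_2[h_1 h_{n-1}]` for `n ≥ 3` (partitions written as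
weakly decreasing lists of parts). -/
theorem schur_expansion_h2_h1hn1 (n : ℕ) (hn : 3 ≤ n) :
    pleth (hh 2) (hh 1 * hh (n - 1)) =
      (∑ a ∈ (Finset.Icc 1 (n - 1)).filter (fun a => Odd a),
          schur [2 * n - 2 - a, a, 1, 1]) +
      (∑ a ∈ (Finset.Icc 2 (n - 1)).filter (fun a => Even a),
          schur [2 * n - 2 - a, a, 2]) +
      schur [2 * n - 2, 1, 1] +
      2 * (∑ a ∈ Finset.Icc 2 (n - 1), schur [2 * n - 1 - a, a, 1]) +
      schur [2 * n - 1, 1] +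
      3 * (∑ a ∈ (Finset.Icc 2 (n - 1)).filter (fun a => Even a),
          schur [2 * n - a, a]) +
      (∑ a ∈ (Finset.Icc 2 (n - 1)).filter (fun a => Odd a),
          schur [2 * n - a, a]) +
      (if Even n then 2 * schur [n, n] else 0) +
      schur [2 * n] := by
  obtain ⟨m, rfl⟩ : ∃ m, n = m + 1 := ⟨n - 1, by omega⟩
  simp only [Nat.add_sub_cancel]
  obtain ⟨A, hA⟩ : ∃ A : ℕ → SymF, ∀ i j, i + j = 2 * m → A i = hh i * hh j :=
    ⟨fun i => hh i * hh (2 * m - i), fun i j h => by simp [← h]⟩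
  obtain ⟨B, hB⟩ : ∃ B : ℕ → SymF, ∀ i j, i + j = 2 * m + 1 → B i = hh i * hh j :=
    ⟨fun i => hh i * hh (2 * m + 1 - i), fun i j h => by simp [← h]⟩
  obtain ⟨C, hC⟩ : ∃ C : ℕ → SymF, ∀ i j, i + j = 2 * m + 2 → C i = hh i * hh j :=
    ⟨fun i => hh i * hh (2 * m + 2 - i), fun i j h => by simp [← h]⟩
  have h0 : hh 0 = 1 := rfl
  have e1 : ∀ a ∈ (Finset.Icc 1 m).filter (fun a => Odd a),
      schur [2 * (m + 1) - 2 - a, a, 1, 1] =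
        (hh 1 ^ 2 - hh 2) * (A a - A (a - 1)) - hh 1 * (B (a + 1) - B (a - 1)) +
          (C (a + 2) - C (a - 1)) := fun a ha => by
    obtain ⟨p, q, rfl, hp⟩ : ∃ p q, a = q + 1 ∧ 2 * m = p + (q + 1) :=
      ⟨2 * m - a, a - 1, by grind, by grind⟩
    rw [show 2 * (m + 1) - 2 - (q + 1) = p by omega, schur_four_rows_one_one,
      Nat.add_sub_cancel, hA (q + 1) p (by omega), hA q (p + 1) (by omega),
      hB (q + 2) p (by omega), hB q (p + 2) (by omega),
      hC (q + 3) p (by omega), hC q (p + 3) (by omega)]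
    ring
  have e2 : ∀ a ∈ (Finset.Icc 2 m).filter (fun a => Even a),
      schur [2 * (m + 1) - 2 - a, a, 2] =
        hh 2 * (A a - A (a - 1)) - hh 1 * (B (a + 1) - B (a - 1)) +
          (C (a + 1) - C a) := fun a ha => by
    obtain ⟨p, q, rfl, hp⟩ : ∃ p q, a = q + 1 ∧ 2 * m = p + (q + 1) :=
      ⟨2 * m - a, a - 1, by grind, by grind⟩
    rw [show 2 * (m + 1) - 2 - (q + 1) = p by omega, schur_three_rows_two,
      Nat.add_sub_cancel, hA (q + 1) p (by omega), hA q (p + 1) (by omega),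
      hB (q + 2) p (by omega), hB q (p + 2) (by omega),
      hC (q + 2) (p + 1) (by omega), hC (q + 1) (p + 2) (by omega)]
    ring
  have e3 : ∀ a ∈ Finset.Icc 2 m, schur [2 * (m + 1) - 1 - a, a, 1] =
      hh 1 * (B a - B (a - 1)) - (C (a + 1) - C (a - 1)) := fun a ha => by
    obtain ⟨p, q, rfl, hp⟩ : ∃ p q, a = q + 1 ∧ 2 * m + 1 = p + (q + 1) :=
      ⟨2 * m + 1 - a, a - 1, by grind, by grind⟩
    rw [show 2 * (m + 1) - 1 - (q + 1) = p by omega, schur_three_rows_one,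
      Nat.add_sub_cancel, hB (q + 1) p (by omega), hB q (p + 1) (by omega),
      hC (q + 2) p (by omega), hC q (p + 2) (by omega)]
    ring
  have e4 : ∀ a ∈ Finset.Icc 2 m,
      schur [2 * (m + 1) - a, a] = C a - C (a - 1) := fun a ha => by
    obtain ⟨p, q, rfl, hp⟩ : ∃ p q, a = q + 1 ∧ 2 * m + 2 = p + (q + 1) :=
      ⟨2 * m + 2 - a, a - 1, by grind, by grind⟩
    rw [show 2 * (m + 1) - (q + 1) = p by omega, schur_two_rows,
      Nat.add_sub_cancel, hC (q + 1) p (by omega), hC q (p + 1) (by omega)]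
    ring
  have hp2 : psub 2 (hh 1) = 2 * hh 2 - hh 1 ^ 2 := by
    rw [psub_two_hh]
    simp [Finset.sum_range_succ, h0]
    ring
  have hpm : psub 2 (hh m) =
      2 * (∑ i ∈ Finset.range m, (-1) ^ i * A i) + (-1) ^ m * A m := by
    rw [psub_two_hh, ← sum_alternating_symmetric A m fun i hi => by
      rw [hA (2 * m - i) i (by omega), hA i (2 * m - i) (by omega), mul_comm]]
    exact Finset.sum_congr rfl fun i hi => by
      rw [hA i (2 * m - i) (by have := Finset.mem_range.mp hi; omega)]
  have key := telescoping_identity A B C (hh 1) (hh 2) m (by omega)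
  have h2 : (2 : SymF) ≠ 0 := two_ne_zero
  refine mul_left_cancel₀ h2 ?_
  rw [pleth_hh_two, psub_mul, psub_mul, psub_one_hh, psub_one_hh, hp2, hpm,
    Finset.sum_congr rfl e1, Finset.sum_congr rfl e2, Finset.sum_congr rfl e3,
    Finset.sum_congr rfl fun a ha => e4 a (Finset.mem_filter.mp ha).1,
    Finset.sum_congr rfl fun a ha => e4 a (Finset.mem_filter.mp ha).1,
    schur_three_rows_one _ 0, schur_two_rows _ 0, schur_two_rows _ m, schur_one_row,
    show 2 * (m + 1) - 2 = 2 * m by omega, show 2 * (m + 1) - 1 = 2 * m + 1 by omega,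
    show 2 * (m + 1) = 2 * m + 2 by ring]
  have hAm := hA m m (by omega)
  have hA0 := hA 0 (2 * m) (by omega)
  have hB0 := hB 0 (2 * m + 1) (by omega)
  have hB1 := hB 1 (2 * m) (by omega)
  have hBm : B (m + 1) = B m := by
    rw [hB (m + 1) m (by omega), hB m (m + 1) (by omega), mul_comm]
  have hC0 := hC 0 (2 * m + 2) (by omega)
  have hC1 := hC 1 (2 * m + 1) (by omega)
  have hC2 := hC 2 (2 * m) (by omega)
  have hCm := hC m (m + 2) (by omega)
  have hCm1 := hC (m + 1) (m + 1) (by omega)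
  have hCm2 := hC (m + 2) m (by omega)
  rw [h0, one_mul] at hA0 hB0 hC0
  generalize (∑ i ∈ Finset.range m, (-1) ^ i * A i) = S at *
  rcases Nat.even_or_odd m with h | h
  · have h' := Nat.not_even_iff_odd.mpr h.add_one
    simp only [h, h', if_true, if_false, h.neg_one_pow, hAm, hA0, hB0, hB1,
      hBm, hC0, hC1, hC2, hCm, hCm1, hCm2, h0, zero_add, add_assoc, Nat.reduceAdd] at key ⊢
    linear_combination -2 * key
  · have h' := h.add_one
    simp only [h', Nat.not_even_iff_odd.mpr h, if_true, if_false, h.neg_one_pow, hAm,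
      hA0, hB0, hB1,
      hBm, hC0, hC1, hC2, hCm, hCm1, hCm2, h0, zero_add, add_assoc, Nat.reduceAdd] at key ⊢
    linear_combination -2 * key
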